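/- arXiv:0901.3833 — 5 statements merged into one kernel-verified Lean document; each statement's English description precedes it below -/
import Mathlib

section
/- Let p be an odd prime, G a finite p-group, and V a faithful 𝔽_p G-module such that no non-identity element of Ω₁(Z(G)) is quadratic on V. If the derived subgroup G' = [G,G] is abelian (i.e. G is metabelian), then V is not an F-module. -/
open Polynomial

section Defs

variable (p : ℕ) {G V : Type*} [Group G] [AddCommGroup V] [Module (ZMod p) V]

/-- The fixed-point subspace `C_V(H)` of a subgroup `H ≤ G`. -/
def fixedPts (ρ : Representation (ZMod p) G V) (H : Subgroup G) :
    Submodule (ZMod p) V where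
  carrier := {v | ∀ h ∈ H, ρ h v = v}
  add_mem' := by
    intro a b ha hb h hh
    simp [map_add, ha h hh, hb h hh]
  zero_mem' := by
    intro h hh
    simp
  smul_mem' := by
    intro c v hv h hh
    simp [map_smul, hv h hh]

/-- `E` is an elementary abelian `p`-subgroup. -/
def IsElemAbelian (E : Subgroup G) : Prop :=
  (∀ x ∈ E, x ^ p = 1) ∧ ∀ x ∈ E, ∀ y ∈ E, x * y = y * x

/-- `E` is an offender of `G` on `V`. -/
def IsOffender (ρ : Representation (ZMod p) G V) (E : Subgroup G) : Prop :=
  E ≠ ⊥ ∧ IsElemAbelian p E ∧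
    Nat.card V ≤ Nat.card E * Nat.card (fixedPts p ρ E)

/-- `j_H(V) = |H|·|C_V(H)|/|V|`. -/
noncomputable def jval (ρ : Representation (ZMod p) G V) (H : Subgroup G) : ℚ :=
  ((Nat.card H : ℚ) * (Nat.card (fixedPts p ρ H) : ℚ)) / (Nat.card V : ℚ)

/-- A non-identity element `g` is quadratic on `V`: `(g-1)² = 0` on `V`. -/
def IsQuadElt (ρ : Representation (ZMod p) G V) (g : G) : Prop :=
  g ≠ 1 ∧ (ρ g - 1) ^ 2 = 0

/-- `[V,E,E] = 0`. -/
def IsQuadSubgroup (ρ : Representation (ZMod p) G V) (E : Subgroup G) : Prop :=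
  ∀ e ∈ E, ∀ f ∈ E, (ρ e - 1) * (ρ f - 1) = 0

/-- The set `𝒫(G,V)` of best offenders. -/
def bestOffenders (ρ : Representation (ZMod p) G V) : Set (Subgroup G) :=
  {E | E ≠ ⊥ ∧ IsElemAbelian p E ∧
    ∀ F : Subgroup G, F ≤ E → jval p ρ F ≤ jval p ρ E}

end Defs

/-- The fixed-point set of a nontrivial normal subgroup of a `p`-group under conjugation. -/
theorem IsPGroup.exists_ne_one_mem_center {p : ℕ} [Fact p.Prime] {G : Type*} [Group G] [Finite G]
    (hG : IsPGroup p G) {N : Subgroup G} (hN : N.Normal) (hne : N ≠ ⊥) :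
    ∃ z ∈ N, z ∈ Subgroup.center G ∧ z ≠ 1 := by
  have : Nontrivial N := (Subgroup.nontrivial_iff_ne_bot N).2 hne
  obtain ⟨b, hb, hb1⟩ :=
    (hG.of_equiv ConjAct.toConjAct).exists_fixed_point_of_prime_dvd_card_of_fixed_point N
      (((hG.to_subgroup N).card_eq_or_dvd).resolve_left Finite.one_lt_card.ne')
      (a := 1) (fun g => smul_one g)
  refine ⟨b, b.2, Subgroup.mem_center_iff.2 fun g => ?_, fun h => hb1 (Subtype.ext h.symm)⟩
  have h := congrArg Subtype.val (hb (ConjAct.toConjAct g))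
  rw [ConjAct.Subgroup.val_conj_smul, ConjAct.toConjAct_smul] at h
  exact mul_inv_eq_iff_eq_mul.1 h

theorem Subgroup.card_mul_card_le_card_sup_mul_card_inf {G : Type*} [Group G] [Finite G]
    (H K : Subgroup G) :
    Nat.card H * Nat.card K ≤ Nat.card (H ⊔ K : Subgroup G) * Nat.card (H ⊓ K : Subgroup G) := by
  have h1 := Subgroup.relIndex_mul_relIndex ⊥ H (H ⊔ K) bot_le le_sup_left
  have h2 := Subgroup.relIndex_mul_relIndex ⊥ (H ⊓ K) K bot_le inf_le_right
  rw [Subgroup.inf_relIndex_right, Subgroup.relIndex_bot_left, Subgroup.relIndex_bot_left] at h2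
  rw [Subgroup.relIndex_bot_left, Subgroup.relIndex_bot_left] at h1
  have h3 : H.relIndex K ≤ H.relIndex (H ⊔ K) :=
    Subgroup.relIndex_le_of_le_right le_sup_right
      (fun h => by rw [h, mul_zero] at h1; exact Nat.card_pos.ne h1)
  rw [← h1, ← h2]
  calc _ = H.relIndex K * (Nat.card H * Nat.card (H ⊓ K : Subgroup G)) := by ring
    _ ≤ H.relIndex (H ⊔ K) * (Nat.card H * Nat.card (H ⊓ K : Subgroup G)) := by gcongr
    _ = _ := by ring

theorem Submodule.card_mul_card_eq_card_sup_mul_card_inf {K V : Type*} [Field K] [Finite K]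
    [AddCommGroup V] [Module K V] [Finite V] (X Y : Submodule K V) :
    Nat.card X * Nat.card Y = Nat.card (X ⊔ Y : Submodule K V) *
      Nat.card (X ⊓ Y : Submodule K V) := by
  rw [Module.natCard_eq_pow_finrank (K := K) (V := X),
    Module.natCard_eq_pow_finrank (K := K) (V := Y),
    Module.natCard_eq_pow_finrank (K := K) (V := (X ⊔ Y : Submodule K V)),
    Module.natCard_eq_pow_finrank (K := K) (V := (X ⊓ Y : Submodule K V)), ← pow_add, ← pow_add,
    Submodule.finrank_sup_add_finrank_inf_eq]

theorem CommRing.quadratic_of_quadratic_mul {k R : Type*} [Field k] [CommRing R] [Algebra k R]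
    (h2 : (2 : k) ≠ 0) {B C : R} (h0 : (B - 1) ^ 2 = 0) (h1 : (B * C - 1) ^ 2 = 0)
    (h3 : (B * C ^ 2 - 1) ^ 2 = 0) : (C - 1) ^ 2 = 0 := by
  have hu : IsUnit (2 : R) := by
    have := (IsUnit.mk0 _ h2).map (algebraMap k R)
    rwa [map_ofNat] at this
  have key : 2 * (C - 1) ^ 2 = 0 := by
    obtain ⟨b, rfl⟩ : ∃ b, B = 1 + b := ⟨B - 1, by ring⟩
    obtain ⟨x, hx⟩ : ∃ x, x = (1 + b) * C - 1 := ⟨_, rfl⟩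
    have hb : b ^ 2 = 0 := by linear_combination h0
    have hx2 : x ^ 2 = 0 := by rw [hx]; exact h1
    have hC : C = 1 + (x - b - b * x) := by rw [hx]; linear_combination C * hb
    have hy : (1 + b) * C ^ 2 - 1 = 2 * x - b - 2 * b * x := by
      rw [hC]
      linear_combination (1 - b) * hx2 - (1 - b) * (1 + x) ^ 2 * hb
    rw [hy] at h3
    rw [hC]
    linear_combination h3 + (2 * (1 - b) ^ 2 - (4 - 8 * b + 4 * b ^ 2)) * hx2
      + (2 * (1 + 2 * x) - (1 + 4 * x)) * hb
  exact (hu.mul_right_eq_zero).1 key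

open scoped IsMulCommutative in
/-- If `B`, `B C`, `B C²` are quadratic and commute, then so is `C`. -/
theorem quadratic_of_quadratic_mul {k R : Type*} [Field k] [Ring R] [Algebra k R]
    (h2 : (2 : k) ≠ 0) {B C : R} (hBC : B * C = C * B) (h0 : (B - 1) ^ 2 = 0)
    (h1 : (B * C - 1) ^ 2 = 0) (h3 : (B * C ^ 2 - 1) ^ 2 = 0) : (C - 1) ^ 2 = 0 := by
  have hcomm : ∀ a ∈ ({B, C} : Set R), ∀ b ∈ ({B, C} : Set R), a * b = b * a := by
    rintro a (rfl | rfl) b (rfl | rfl) <;> first | rfl | exact hBC | exact hBC.symm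
  have := Algebra.isMulCommutative_adjoin k hcomm
  let B' : Algebra.adjoin k ({B, C} : Set R) := ⟨B, Algebra.subset_adjoin (by simp)⟩
  let C' : Algebra.adjoin k ({B, C} : Set R) := ⟨C, Algebra.subset_adjoin (by simp)⟩
  have := CommRing.quadratic_of_quadratic_mul (k := k) h2 (B := B') (C := C') (Subtype.ext h0)
    (Subtype.ext h1) (Subtype.ext h3)
  exact congrArg Subtype.val this

section Quadratic

open scoped commutatorElement

variable {p : ℕ} [Fact p.Prime] {G V : Type*} [Group G] [AddCommGroup V] [Module (ZMod p) V]
  {ρ : Representation (ZMod p) G V}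

theorem pow_eq_one_of_quadratic (hρ : Function.Injective ρ) {g : G} (hg : (ρ g - 1) ^ 2 = 0) :
    g ^ p = 1 := by
  apply hρ
  have hp : (p : Module.End (ZMod p) V) = 0 := by
    rw [← map_natCast (algebraMap (ZMod p) (Module.End (ZMod p) V)), CharP.cast_eq_zero, map_zero]
  obtain ⟨r, hr⟩ := (Commute.one_right (ρ g - 1)).exists_add_pow_prime_eq (Fact.out : p.Prime)
  rw [sub_add_cancel, pow_eq_zero_of_le (Fact.out : p.Prime).two_le hg, hp] at hr
  rw [map_pow, map_one, hr]
  simp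

/-- A normal subgroup consisting of quadratic elements meets `Ω₁(Z(G))`. -/
theorem eq_bot_of_normal_of_quadratic [Finite G] (hG : IsPGroup p G) (hρ : Function.Injective ρ)
    (hnoquad : ∀ g ∈ Subgroup.center G, g ^ p = 1 → ¬ IsQuadElt p ρ g)
    {N : Subgroup G} (hN : N.Normal) (hq : ∀ g ∈ N, (ρ g - 1) ^ 2 = 0) : N = ⊥ := by
  by_contra hne
  obtain ⟨z, hz, hzc, hz1⟩ := hG.exists_ne_one_mem_center hN hne
  exact hnoquad z hzc (pow_eq_one_of_quadratic hρ (hq z hz)) ⟨hz1, hq z hz⟩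

theorem quadratic_conj {g : G} (hg : (ρ g - 1) ^ 2 = 0) (a : G) :
    (ρ (a * g * a⁻¹) - 1) ^ 2 = 0 := by
  have h1 : ρ a * ρ a⁻¹ = 1 := by rw [← map_mul, mul_inv_cancel, map_one]
  have h2 : ρ a⁻¹ * ρ a = 1 := by rw [← map_mul, inv_mul_cancel, map_one]
  have h3 : ρ (a * g * a⁻¹) - 1 = ρ a * (ρ g - 1) * ρ a⁻¹ := by
    rw [map_mul, map_mul, mul_sub, sub_mul, mul_one, h1]
  rw [h3, sq]
  calc _ = ρ a * (ρ g - 1) * (ρ a⁻¹ * ρ a) * (ρ g - 1) * ρ a⁻¹ := by simp only [mul_assoc]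
    _ = ρ a * (ρ g - 1) ^ 2 * ρ a⁻¹ := by rw [h2]; simp only [sq, mul_assoc, one_mul]
    _ = 0 := by rw [hg, mul_zero, zero_mul]

/-- If `g` is quadratic and `c = [a, g]` commutes with `a` and `g`, then `c` is quadratic. -/
theorem quadratic_commutator (hodd : Odd p) {a g : G} (hg : (ρ g - 1) ^ 2 = 0)
    (hcg : Commute ⁅a, g⁆ g) (hca : Commute ⁅a, g⁆ a) : (ρ ⁅a, g⁆ - 1) ^ 2 = 0 := by
  have h2 : (2 : ZMod p) ≠ 0 :=
    ZMod.prime_ne_zero p 2 (by rintro rfl; exact absurd hodd (by decide))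
  have e1 : a * g * a⁻¹ = g * ⁅a, g⁆ := by
    rw [← hcg.eq, commutatorElement_def]; group
  have e2 : a * (a * g * a⁻¹) * a⁻¹ = g * ⁅a, g⁆ ^ 2 := by
    calc _ = a * g * ⁅a, g⁆ * a⁻¹ := by rw [e1]; group
      _ = a * g * a⁻¹ * ⁅a, g⁆ := by
        rw [mul_assoc _ _ a⁻¹, (hca.inv_right).eq, ← mul_assoc]
      _ = _ := by rw [e1, sq, mul_assoc]
  have h1 := quadratic_conj hg a
  have h3 := quadratic_conj h1 a
  rw [e1, map_mul] at h1
  rw [e2, map_mul, map_pow] at h3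
  exact quadratic_of_quadratic_mul h2 (by rw [← map_mul, ← map_mul, hcg.eq]) hg h1 h3

/-- `b ↦ [b, e]` as a homomorphism on a subgroup of an abelian derived subgroup. -/
def commutatorHom (hmeta : ∀ a ∈ commutator G, ∀ b ∈ commutator G, a * b = b * a)
    (e : G) (B : Subgroup G) (hB : B ≤ commutator G) : B →* G where
  toFun b := ⁅(b : G), e⁆
  map_one' := by simp
  map_mul' b c := by
    have h := hmeta b (hB b.2) ⁅(c : G), e⁆ (Subgroup.commutator_mem_commutator trivial trivial)
    have h' := hmeta ⁅(b : G), e⁆ (Subgroup.commutator_mem_commutator trivial trivial) ⁅(c : G), e⁆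
      (Subgroup.commutator_mem_commutator trivial trivial)
    calc ⁅((b * c : B) : G), e⁆ = b * ⁅(c : G), e⁆ * (b : G)⁻¹ * ⁅(b : G), e⁆ := by
          simp only [commutatorElement_def, Subgroup.coe_mul]; group
      _ = _ := by rw [h, mul_inv_cancel_right, h']

/-- In a metabelian group with no central quadratic elements, every quadratic element
centralizes the derived subgroup. -/
theorem commute_commutator_of_quadratic [Finite G] (hodd : Odd p) (hG : IsPGroup p G)
    (hρ : Function.Injective ρ)
    (hnoquad : ∀ g ∈ Subgroup.center G, g ^ p = 1 → ¬ IsQuadElt p ρ g)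
    (hmeta : ∀ a ∈ commutator G, ∀ b ∈ commutator G, a * b = b * a)
    {e : G} (he : (ρ e - 1) ^ 2 = 0) {a : G} (ha : a ∈ commutator G) : a * e = e * a := by
  suffices H : ∀ (n : ℕ) (B : Subgroup G), Nat.card B ≤ n → B.Normal → B ≤ commutator G →
      ∀ b ∈ B, b * e = e * b from
    H _ (commutator G) le_rfl inferInstance le_rfl a ha
  intro n
  induction n with
  | zero => exact fun B h => absurd h (Nat.not_le.2 Nat.card_pos)
  | succ n ih =>
    intro B hcard hN hB b hb
    have hmem : ∀ x y : G, ⁅x, y⁆ ∈ commutator G := fun x y =>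
      Subgroup.commutator_mem_commutator trivial trivial
    set φ := commutatorHom hmeta e B hB
    have hφa : ∀ x : B, φ x = ⁅(x : G), e⁆ := fun x => rfl
    have hle : φ.range ≤ B := by
      rintro _ ⟨x, rfl⟩
      rw [hφa, commutatorElement_def, mul_assoc, mul_assoc, ← mul_assoc e]
      exact B.mul_mem x.2 (hN.conj_mem _ (B.inv_mem x.2) e)
    have hnormal : φ.range.Normal := by
      refine ⟨?_⟩
      rintro _ ⟨x, rfl⟩ g
      refine ⟨⟨g * x * g⁻¹, hN.conj_mem _ x.2 g⟩, ?_⟩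
      rw [hφa, hφa]
      have h1 := hmeta ⁅g * x * g⁻¹, e⁆ (hmem _ _) ⁅g, e⁆ (hmem _ _)
      have h2 := hmeta (g * x * g⁻¹) (hB (hN.conj_mem _ x.2 g)) ⁅g, e⁆ (hmem _ _)
      have h3 : g * ⁅(x : G), e⁆ * g⁻¹ = ⁅g * x * g⁻¹, ⁅g, e⁆ * e⁆ := by
        simp only [commutatorElement_def]; group
      have h4 : ⁅g * x * g⁻¹, ⁅g, e⁆ * e⁆ =
          (g * x * g⁻¹ * ⁅g, e⁆) * e * (g * x * g⁻¹)⁻¹ * e⁻¹ * ⁅g, e⁆⁻¹ := by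
        simp only [commutatorElement_def]; group
      rw [h3, h4, h2]
      have h5 : ⁅g, e⁆ * (g * x * g⁻¹) * e * (g * x * g⁻¹)⁻¹ * e⁻¹ * ⁅g, e⁆⁻¹ =
          ⁅g, e⁆ * ⁅g * x * g⁻¹, e⁆ * ⁅g, e⁆⁻¹ := by
        simp only [commutatorElement_def]; group
      rw [h5, ← h1, mul_inv_cancel_right]
    have hcomm : ∀ c ∈ φ.range, c * e = e * c := by
      by_cases hbot : B = ⊥
      · intro c hc
        have := hle hc
        rw [hbot, Subgroup.mem_bot] at this
        simp [this]
      refine ih φ.range (Nat.le_of_lt_succ (lt_of_lt_of_le ?_ hcard)) hnormal (hle.trans hB)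
      refine lt_of_le_of_ne (Subgroup.card_le_of_le hle) fun hc => ?_
      have hinj : Function.Injective φ.rangeRestrict :=
        ((Nat.bijective_iff_surjective_and_card _).2 ⟨φ.rangeRestrict_surjective, hc.symm⟩).1
      obtain ⟨z, hz, hzc, hz1⟩ := hG.exists_ne_one_mem_center hN hbot
      have : φ.rangeRestrict ⟨z, hz⟩ = φ.rangeRestrict 1 := by
        apply Subtype.ext
        rw [MonoidHom.coe_rangeRestrict, MonoidHom.coe_rangeRestrict, map_one, hφa]
        exact commutatorElement_eq_one_iff_mul_comm.2 (Subgroup.mem_center_iff.1 hzc e).symm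
      exact hz1 (congrArg Subtype.val (hinj this))
    have hbot := eq_bot_of_normal_of_quadratic hG hρ hnoquad hnormal (by
      rintro _ ⟨x, rfl⟩
      exact quadratic_commutator hodd he (hcomm _ ⟨x, rfl⟩) (hmeta _ (hmem _ _) _ (hB x.2)))
    have hb1 : φ ⟨b, hb⟩ ∈ φ.range := ⟨_, rfl⟩
    rw [hbot, Subgroup.mem_bot, hφa] at hb1
    exact commutatorElement_eq_one_iff_mul_comm.1 hb1

end Quadratic

section Offenders

variable {p : ℕ} {G V : Type*} [Group G] [AddCommGroup V] [Module (ZMod p) V]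
  {ρ : Representation (ZMod p) G V}

theorem IsElemAbelian.mono {E F : Subgroup G} (hE : IsElemAbelian p E) (h : F ≤ E) :
    IsElemAbelian p F :=
  ⟨fun x hx => hE.1 x (h hx), fun x hx y hy => hE.2 x (h hx) y (h hy)⟩

theorem IsElemAbelian.sup {E F : Subgroup G} (hE : IsElemAbelian p E) (hF : IsElemAbelian p F)
    (hEF : ∀ x ∈ E, ∀ y ∈ F, x * y = y * x) : IsElemAbelian p (E ⊔ F) := by
  have hEc : E ⊔ F ≤ Subgroup.centralizer E := sup_le
    (fun x hx => Subgroup.mem_centralizer_iff.2 fun y hy => hE.2 y hy x hx)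
    (fun x hx => Subgroup.mem_centralizer_iff.2 fun y hy => hEF y hy x hx)
  have hFc : E ⊔ F ≤ Subgroup.centralizer F := sup_le
    (fun x hx => Subgroup.mem_centralizer_iff.2 fun y hy => (hEF x hx y hy).symm)
    (fun x hx => Subgroup.mem_centralizer_iff.2 fun y hy => hF.2 y hy x hx)
  have hcomm : ∀ x ∈ E ⊔ F, ∀ y ∈ E ⊔ F, x * y = y * x := by
    have h : E ⊔ F ≤ Subgroup.centralizer (E ⊔ F : Subgroup G) := sup_le
      (fun x hx => Subgroup.mem_centralizer_iff.2 fun y hy =>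
        (Subgroup.mem_centralizer_iff.1 (hEc hy) x hx).symm)
      (fun x hx => Subgroup.mem_centralizer_iff.2 fun y hy =>
        (Subgroup.mem_centralizer_iff.1 (hFc hy) x hx).symm)
    exact fun x hx y hy => Subgroup.mem_centralizer_iff.1 (h hy) x hx
  refine ⟨fun x hx => ?_, hcomm⟩
  rw [Subgroup.sup_eq_closure] at hx
  induction hx using Subgroup.closure_induction with
  | mem x h => exact h.elim (hE.1 x) (hF.1 x)
  | one => exact one_pow p
  | mul x y hx hy ihx ihy =>
    rw [← Subgroup.sup_eq_closure] at hx hy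
    rw [(show Commute x y from hcomm x hx y hy).mul_pow, ihx, ihy, one_mul]
  | inv x hx ih => rw [inv_pow, ih, inv_one]

theorem fixedPts_anti {E F : Subgroup G} (h : E ≤ F) : fixedPts p ρ F ≤ fixedPts p ρ E :=
  fun _ hv e he => hv e (h he)

theorem fixedPts_sup (E F : Subgroup G) :
    fixedPts p ρ (E ⊔ F) = fixedPts p ρ E ⊓ fixedPts p ρ F := by
  refine le_antisymm (le_inf (fixedPts_anti le_sup_left) (fixedPts_anti le_sup_right)) ?_
  intro v hv
  let S : Subgroup G :=
    { carrier := {g | ρ g v = v}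
      mul_mem' := fun {a b} ha hb => by
        simp only [Set.mem_ofPred_eq] at *
        rw [map_mul, Module.End.mul_apply, hb, ha]
      one_mem' := by simp
      inv_mem' := fun {a} ha => by
        simp only [Set.mem_ofPred_eq] at *
        conv_lhs => rw [← ha]
        rw [← Module.End.mul_apply, ← map_mul, inv_mul_cancel, map_one, Module.End.one_apply] }
  have hS : E ⊔ F ≤ S := sup_le (fun e he => hv.1 e he) (fun f hf => hv.2 f hf)
  exact fun g hg => hS hg

/-- The numerator `|E|·|C_V(E)|` of `j_E(V)`. -/
noncomputable def fixCard (ρ : Representation (ZMod p) G V) (E : Subgroup G) : ℕ :=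
  Nat.card E * Nat.card (fixedPts p ρ E)

/-- `E` is an elementary abelian subgroup with `j_E(V)` as large as possible. -/
def IsMaxElem (ρ : Representation (ZMod p) G V) (E : Subgroup G) : Prop :=
  IsElemAbelian p E ∧ ∀ F : Subgroup G, IsElemAbelian p F → fixCard ρ F ≤ fixCard ρ E

theorem le_fixCard_map_conj [Finite G] [Finite V] (E : Subgroup G) (g : G) :
    fixCard ρ E ≤ fixCard ρ (E.map (MulAut.conj g).toMonoidHom) := by
  have hmem : ∀ v ∈ fixedPts p ρ E,
      ρ g v ∈ fixedPts p ρ (E.map (MulAut.conj g).toMonoidHom) := by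
    rintro v hv _ ⟨x, hx, rfl⟩
    change ρ (g * x * g⁻¹) (ρ g v) = ρ g v
    rw [← Module.End.mul_apply, ← map_mul, inv_mul_cancel_right, map_mul, Module.End.mul_apply,
      hv x hx]
  have hinj : Function.Injective fun v : fixedPts p ρ E =>
      (⟨ρ g v, hmem v v.2⟩ : fixedPts p ρ (E.map (MulAut.conj g).toMonoidHom)) := fun v w h => by
    have h1 : ρ g v = ρ g w := congrArg Subtype.val h
    have h2 := congrArg (ρ g⁻¹) h1
    simpa using h2
  rw [fixCard, fixCard, Subgroup.card_map_of_injective (MulAut.conj g).injective]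
  exact Nat.mul_le_mul_left _ (Nat.card_le_card_of_injective _ hinj)

theorem IsElemAbelian.map {E : Subgroup G} (hE : IsElemAbelian p E) (f : G →* G) :
    IsElemAbelian p (E.map f) := by
  constructor
  · rintro _ ⟨x, hx, rfl⟩
    rw [← map_pow, hE.1 x hx, map_one]
  · rintro _ ⟨x, hx, rfl⟩ _ ⟨y, hy, rfl⟩
    rw [← map_mul, hE.2 x hx y hy, map_mul]

theorem IsMaxElem.of_le {E F : Subgroup G} (hE : IsMaxElem ρ E) (hF : IsElemAbelian p F)
    (h : fixCard ρ E ≤ fixCard ρ F) : IsMaxElem ρ F :=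
  ⟨hF, fun K hK => (hE.2 K hK).trans h⟩

/-- `[V, E]`. -/
def commSpace (ρ : Representation (ZMod p) G V) (E : Subgroup G) : Submodule (ZMod p) V :=
  Submodule.span (ZMod p) {x | ∃ e ∈ E, ∃ v, x = ρ e v - v}

/-- A `p`-group acting on `V` does not satisfy `V = [V, E] + C_V(E)` unless it acts trivially. -/
theorem fixedPts_eq_top_of_commSpace_sup [Fact p.Prime] [Finite V] {E : Subgroup G} (hE : IsPGroup p E)
    (h : commSpace ρ E ⊔ fixedPts p ρ E = ⊤) : fixedPts p ρ E = ⊤ := by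
  by_contra hne
  let D := (fixedPts p ρ E).dualAnnihilator
  have hD : D ≠ ⊥ := fun hD => hne (Submodule.dualAnnihilator_eq_bot_iff.1 hD)
  let act : MulAction E D :=
    { smul := fun e f => ⟨f.1 ∘ₗ ρ (e : G)⁻¹, (Submodule.mem_dualAnnihilator _).2 fun w hw => by
        rw [LinearMap.comp_apply, hw _ (E.inv_mem e.2)]
        exact (Submodule.mem_dualAnnihilator _).1 f.2 w hw⟩
      one_smul := fun f => Subtype.ext (by
        change f.1 ∘ₗ ρ ((1 : E) : G)⁻¹ = f.1
        simp [Module.End.one_eq_id])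
      mul_smul := fun a b f => Subtype.ext (by
        change f.1 ∘ₗ ρ ((a * b : E) : G)⁻¹ = (f.1 ∘ₗ ρ (b : G)⁻¹) ∘ₗ ρ (a : G)⁻¹
        rw [Subgroup.coe_mul, mul_inv_rev, map_mul]
        rfl) }
  have : Finite (Module.Dual (ZMod p) V) := Finite.of_injective _ DFunLike.coe_injective
  have hdvd : p ∣ Nat.card D := by
    have : Nontrivial D := Submodule.nontrivial_iff_ne_bot.2 hD
    rw [Module.natCard_eq_pow_finrank (K := ZMod p), Nat.card_zmod]
    exact dvd_pow_self p Module.finrank_pos.ne'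
  obtain ⟨f, hf, hf0⟩ := hE.exists_fixed_point_of_prime_dvd_card_of_fixed_point D hdvd (a := 0)
    (fun e => Subtype.ext (LinearMap.zero_comp _))
  apply hf0
  refine Subtype.ext (LinearMap.ext fun w => ?_)
  have hle : (⊤ : Submodule (ZMod p) V) ≤ LinearMap.ker f.1 := by
    rw [← h]
    refine sup_le (Submodule.span_le.2 ?_) fun w hw => (Submodule.mem_dualAnnihilator _).1 f.2 w hw
    rintro _ ⟨e, he, u, rfl⟩
    have h1 : f.1 ∘ₗ ρ ((⟨e, he⟩⁻¹ : E) : G)⁻¹ = f.1 := congrArg Subtype.val (hf (⟨e, he⟩⁻¹ : E))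
    have h2 := LinearMap.congr_fun h1 u
    simp only [Subgroup.coe_inv, inv_inv, LinearMap.comp_apply] at h2
    change f.1 (ρ e u - u) = 0
    rw [map_sub, h2, sub_self]
  exact (LinearMap.mem_ker.1 (hle Submodule.mem_top)).symm

/-- If some offender exists, then the maximum of `j_E(V)` over elementary abelian subgroups is
attained at a nontrivial subgroup. -/
theorem exists_isMaxElem_of_isOffender [Finite G] [Finite V] {E : Subgroup G}
    (hE : IsOffender p ρ E) :
    ∃ F, IsMaxElem ρ F ∧ F ≠ ⊥ := by
  obtain ⟨F, hF, hmax⟩ := Set.exists_max_image {F : Subgroup G | IsElemAbelian p F} (fixCard ρ)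
    (Set.toFinite _) ⟨E, hE.2.1⟩
  by_cases hbot : F = ⊥
  · refine ⟨E, IsMaxElem.of_le ⟨hF, hmax⟩ hE.2.1 (le_trans ?_ hE.2.2), hE.1⟩
    rw [hbot, fixCard, Subgroup.card_bot, one_mul]
    exact Nat.card_le_card_of_injective _ Subtype.val_injective
  · exact ⟨F, ⟨hF, hmax⟩, hbot⟩

variable [Fact p.Prime] [Finite G] [Finite V]

theorem IsMaxElem.sup_inf {E F : Subgroup G} (hE : IsMaxElem ρ E) (hF : IsMaxElem ρ F)
    (hEF : ∀ x ∈ E, ∀ y ∈ F, x * y = y * x) :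
    IsMaxElem ρ (E ⊔ F) ∧ IsMaxElem ρ (E ⊓ F) ∧
      fixedPts p ρ (E ⊓ F) = fixedPts p ρ E ⊔ fixedPts p ρ F := by
  have hs : IsElemAbelian p (E ⊔ F) := hE.1.sup hF.1 hEF
  have hi : IsElemAbelian p (E ⊓ F) := hE.1.mono inf_le_left
  have hle : fixedPts p ρ E ⊔ fixedPts p ρ F ≤ fixedPts p ρ (E ⊓ F) :=
    sup_le (fixedPts_anti inf_le_left) (fixedPts_anti inf_le_right)
  have hm : fixCard ρ E = fixCard ρ F := le_antisymm (hF.2 E hE.1) (hE.2 F hF.1)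
  have h1 := Subgroup.card_mul_card_le_card_sup_mul_card_inf E F
  have h2 := Submodule.card_mul_card_eq_card_sup_mul_card_inf (fixedPts p ρ E) (fixedPts p ρ F)
  have h3 : Nat.card (fixedPts p ρ E ⊔ fixedPts p ρ F : Submodule (ZMod p) V) ≤
      Nat.card (fixedPts p ρ (E ⊓ F)) := Nat.card_mono (Set.toFinite _) hle
  have hs' := hE.2 _ hs
  have hi' := hE.2 _ hi
  have hpos : ∀ K : Subgroup G, 0 < fixCard ρ K := fun K => Nat.mul_pos Nat.card_pos Nat.card_pos
  have hsup : fixCard ρ (E ⊔ F) = Nat.card (E ⊔ F : Subgroup G) *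
      Nat.card (fixedPts p ρ E ⊓ fixedPts p ρ F : Submodule (ZMod p) V) := by
    rw [fixCard, fixedPts_sup]
  set X := Nat.card (fixedPts p ρ E ⊔ fixedPts p ρ F : Submodule (ZMod p) V)
  have h4 : fixCard ρ E * fixCard ρ E ≤
      fixCard ρ (E ⊔ F) * (Nat.card (E ⊓ F : Subgroup G) * X) := by
    calc fixCard ρ E * fixCard ρ E = fixCard ρ E * fixCard ρ F := by rw [← hm]
      _ = (Nat.card E * Nat.card F) * (Nat.card (fixedPts p ρ E) * Nat.card (fixedPts p ρ F)) := by
        rw [fixCard, fixCard]; ring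
      _ ≤ (Nat.card (E ⊔ F : Subgroup G) * Nat.card (E ⊓ F : Subgroup G)) *
          (Nat.card (fixedPts p ρ E) * Nat.card (fixedPts p ρ F)) := by gcongr
      _ = _ := by rw [h2, hsup]; ring
  have h5 : Nat.card (E ⊓ F : Subgroup G) * X ≤ fixCard ρ (E ⊓ F) := Nat.mul_le_mul_left _ h3
  have h6 : fixCard ρ E ≤ fixCard ρ (E ⊔ F) := by
    refine Nat.le_of_mul_le_mul_right ?_ (hpos E)
    exact h4.trans (Nat.mul_le_mul_left _ (h5.trans hi'))
  have h7 : fixCard ρ E ≤ Nat.card (E ⊓ F : Subgroup G) * X := by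
    refine Nat.le_of_mul_le_mul_left ?_ (hpos E)
    exact h4.trans (Nat.mul_le_mul_right _ hs')
  refine ⟨hE.of_le hs h6, hE.of_le hi (h7.trans h5), (SetLike.coe_injective ?_).symm⟩
  refine Set.eq_of_subset_of_ncard_le hle ?_ (Set.toFinite _)
  have h8 : Nat.card (fixedPts p ρ (E ⊓ F)) ≤ X :=
    Nat.le_of_mul_le_mul_left (hi'.trans h7) Nat.card_pos
  exact h8

/-- Replacement by the centralizer of `[v, E]` for a single vector `v`. -/
theorem IsMaxElem.exists_centralizer {E : Subgroup G} (hE : IsMaxElem ρ E) (v : V) :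
    ∃ B ≤ E, IsMaxElem ρ B ∧ (∀ b ∈ B, ∀ e ∈ E, ρ b (ρ e v - v) = ρ e v - v) ∧
      fixedPts p ρ B ≤ commSpace ρ E ⊔ fixedPts p ρ E := by
  let X : Submodule (ZMod p) V := Submodule.span (ZMod p) {x | ∃ e ∈ E, x = ρ e v - v}
  have hcomm : ∀ a ∈ E, ∀ b ∈ E, ∀ w, ρ a (ρ b w) = ρ b (ρ a w) := fun a ha b hb w => by
    rw [← Module.End.mul_apply, ← map_mul, hE.1.2 a ha b hb, map_mul, Module.End.mul_apply]
  have hinv : ∀ (a : G) (w : V), ρ a⁻¹ (ρ a w) = w := fun a w => by simp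
  let B : Subgroup G :=
    { carrier := {b | b ∈ E ∧ ∀ e ∈ E, ρ b (ρ e v - v) = ρ e v - v}
      mul_mem' := fun {a b} ha hb => ⟨E.mul_mem ha.1 hb.1, fun e he => by
        rw [map_mul, Module.End.mul_apply, hb.2 e he, ha.2 e he]⟩
      one_mem' := ⟨E.one_mem, fun e he => by simp⟩
      inv_mem' := fun {a} ha => ⟨E.inv_mem ha.1, fun e he => by
        conv_lhs => rw [← ha.2 e he]
        rw [hinv]⟩ }
  have hBE : B ≤ E := fun b hb => hb.1
  have hXB : X ⊔ fixedPts p ρ E ≤ fixedPts p ρ B := by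
    refine sup_le (Submodule.span_le.2 ?_) (fixedPts_anti hBE)
    rintro _ ⟨e, he, rfl⟩ b hb
    exact hb.2 e he
  have hkey : ∀ a ∈ E, ∀ b ∈ E, ρ a v - ρ b v ∈ fixedPts p ρ E → b⁻¹ * a ∈ B := by
    intro a ha b hb hab
    refine ⟨E.mul_mem (E.inv_mem hb) ha, fun e he => ?_⟩
    have h1 := hab e he
    have h2 : ρ a (ρ e v - v) = ρ b (ρ e v - v) := by
      rw [map_sub, hcomm e he a ha, hcomm e he b hb] at h1
      rw [map_sub, map_sub, sub_eq_sub_iff_sub_eq_sub, h1]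
    rw [map_mul, Module.End.mul_apply, h2, hinv]
  let s : E → E := fun a => (QuotientGroup.mk a : E ⧸ B.subgroupOf E).out
  have hs : ∀ a : E, ((s a : E) : G)⁻¹ * a ∈ B := fun a => by
    have := QuotientGroup.eq.1 (QuotientGroup.out_eq' (QuotientGroup.mk a : E ⧸ B.subgroupOf E))
    exact this
  let f : E × fixedPts p ρ E → B × (X ⊔ fixedPts p ρ E : Submodule (ZMod p) V) := fun x =>
    (⟨_, hs x.1⟩, ⟨(ρ x.1 v - v) + x.2, Submodule.add_mem_sup
      (Submodule.subset_span ⟨x.1, x.1.2, rfl⟩) x.2.2⟩)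
  have hf : Function.Injective f := by
    rintro ⟨a, c⟩ ⟨a', c'⟩ h
    have h1 : ((s a : E) : G)⁻¹ * a = ((s a' : E) : G)⁻¹ * a' :=
      congrArg Subtype.val (congrArg Prod.fst h)
    have h2 : (ρ a v - v) + c = (ρ a' v - v) + c' := congrArg Subtype.val (congrArg Prod.snd h)
    have h3 : ρ a v - ρ a' v = ((c' - c : fixedPts p ρ E) : V) := by
      rw [Submodule.coe_sub, sub_eq_sub_iff_add_eq_add]
      have := congrArg (· + v) h2
      rw [add_right_comm, sub_add_cancel, add_right_comm, sub_add_cancel] at this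
      rw [this, add_comm]
    have h4 : (a' : G)⁻¹ * a ∈ B := hkey a a.2 a' a'.2 (by rw [h3]; exact (c' - c).2)
    have h5 : s a' = s a := by
      have : (QuotientGroup.mk a' : E ⧸ B.subgroupOf E) = QuotientGroup.mk a :=
        QuotientGroup.eq.2 h4
      simp only [s, this]
    rw [h5] at h1
    have h6 : a = a' := Subtype.ext (mul_left_cancel h1)
    subst h6
    rw [Prod.mk.injEq]
    exact ⟨rfl, Subtype.ext (add_left_cancel h2)⟩
  have hcard := Nat.card_le_card_of_injective f hf
  rw [Nat.card_prod, Nat.card_prod] at hcard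
  have hXcard : Nat.card (X ⊔ fixedPts p ρ E : Submodule (ZMod p) V) ≤ Nat.card (fixedPts p ρ B) :=
    Nat.card_mono (Set.toFinite _) hXB
  have hmax := hE.2 B (hE.1.mono hBE)
  have heq : X ⊔ fixedPts p ρ E = fixedPts p ρ B := by
    refine SetLike.coe_injective (Set.eq_of_subset_of_ncard_le hXB ?_ (Set.toFinite _))
    have h8 : Nat.card (fixedPts p ρ B) ≤ Nat.card (X ⊔ fixedPts p ρ E : Submodule (ZMod p) V) :=
      Nat.le_of_mul_le_mul_left (hmax.trans hcard) Nat.card_pos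
    exact h8
  refine ⟨B, hBE, hE.of_le (hE.1.mono hBE) (hcard.trans (Nat.mul_le_mul_left _ hXcard)),
    fun b hb => hb.2, ?_⟩
  rw [← heq]
  refine sup_le_sup_right (Submodule.span_mono ?_) _
  rintro _ ⟨e, he, rfl⟩
  exact ⟨e, he, v, rfl⟩

/-- Timmesfeld's replacement theorem. -/
theorem IsMaxElem.exists_replacement (hG : IsPGroup p G) (hρ : Function.Injective ρ)
    {E : Subgroup G} (hE : IsMaxElem ρ E) (hne : E ≠ ⊥) :
    ∃ B ≤ E, B ≠ ⊥ ∧ IsMaxElem ρ B ∧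
      ∀ b ∈ B, ∀ e ∈ E, ∀ v, ρ b (ρ e v - v) = ρ e v - v := by
  let P : Subgroup G → Prop := fun B =>
    B ≤ E ∧ IsMaxElem ρ B ∧ fixedPts p ρ B ≤ commSpace ρ E ⊔ fixedPts p ρ E
  have hex : ∃ B, P B := by
    obtain ⟨B, h1, h2, -, h3⟩ := hE.exists_centralizer (0 : V)
    exact ⟨B, h1, h2, h3⟩
  obtain ⟨B, hB, hmin⟩ := (Set.toFinite {B | P B}).exists_minimal hex
  have hquad : ∀ b ∈ B, ∀ e ∈ E, ∀ v, ρ b (ρ e v - v) = ρ e v - v := by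
    intro b hb e he v
    obtain ⟨C, h1, h2, h3, h4⟩ := hE.exists_centralizer v
    obtain ⟨-, h5, h6⟩ := hB.2.1.sup_inf h2
      (fun x hx y hy => hE.1.2 x (hB.1 hx) y (h1 hy))
    have : P (B ⊓ C) := ⟨inf_le_left.trans hB.1, h5, h6 ▸ sup_le hB.2.2 h4⟩
    exact h3 b (hmin this inf_le_left hb).2 e he
  refine ⟨B, hB.1, fun hbot => hne ?_, hB.2.1, hquad⟩
  have htop : fixedPts p ρ (⊥ : Subgroup G) = ⊤ := by
    refine eq_top_iff.2 fun v _ g hg => ?_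
    rw [Subgroup.mem_bot] at hg
    simp [hg]
  have h1 : commSpace ρ E ⊔ fixedPts p ρ E = ⊤ := by
    rw [eq_top_iff, ← htop, ← hbot]
    exact hB.2.2
  have h2 := fixedPts_eq_top_of_commSpace_sup (hG.to_subgroup E) h1
  refine (Subgroup.eq_bot_iff_forall E).2 fun e he => hρ (LinearMap.ext fun v => ?_)
  have hv : v ∈ fixedPts p ρ E := h2 ▸ Submodule.mem_top
  rw [map_one, Module.End.one_apply, hv e he]

end Offenders

/-- **Theorem (metabelian case).** Let `p` be an odd prime, `G` a finite `p`-group and `V`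
a faithful `𝔽_p G`-module such that no non-identity element of `Ω₁(Z(G))` is quadratic
on `V`.  If the derived subgroup `G' = [G,G]` is abelian, then `V` is not an `F`-module. -/
theorem stmt1 {p : ℕ} (hp : p.Prime) (hodd : Odd p) {G V : Type*} [Group G] [Finite G]
    [AddCommGroup V] [Module (ZMod p) V] [Finite V]
    (hG : IsPGroup p G) (ρ : Representation (ZMod p) G V)
    (hfaithful : Function.Injective ρ)
    (hnoquad : ∀ g ∈ Subgroup.center G, g ^ p = 1 → ¬ IsQuadElt p ρ g)
    (hmeta : ∀ a ∈ commutator G, ∀ b ∈ commutator G, a * b = b * a) :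
    ¬ ∃ E : Subgroup G, IsOffender p ρ E := by
  have := Fact.mk hp
  rintro ⟨E, hE⟩
  have hcm : ∀ x y : G, x * y * x⁻¹ * y⁻¹ ∈ commutator G := fun x y =>
    Subgroup.commutator_mem_commutator (H₁ := ⊤) (H₂ := ⊤) trivial trivial
  obtain ⟨E₀, hE₀, hE₀'⟩ := exists_isMaxElem_of_isOffender hE
  obtain ⟨E₁, hle, hE₁', hE₁, hE₁q⟩ := hE₀.exists_replacement hG hfaithful hE₀'
  have hquad : ∀ b, (∀ v, ρ b (ρ b v - v) = ρ b v - v) → (ρ b - 1) ^ 2 = 0 := fun b hb =>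
    LinearMap.ext fun v => by
      rw [sq, Module.End.mul_apply, LinearMap.sub_apply, LinearMap.sub_apply, Module.End.one_apply,
        Module.End.one_apply, hb, sub_self, LinearMap.zero_apply]
  let P : Subgroup G → Prop := fun M =>
    IsMaxElem ρ M ∧ M ≠ ⊥ ∧ ∀ x ∈ M, ∀ a ∈ commutator G, a * x = x * a
  have hP : P E₁ := ⟨hE₁, hE₁', fun x hx a ha =>
    commute_commutator_of_quadratic hodd hG hfaithful hnoquad hmeta
      (hquad x (hE₁q x hx x (hle hx))) ha⟩
  obtain ⟨M, ⟨hM, hM', hMc⟩, hmax⟩ := (Set.toFinite {M | P M}).exists_maximal ⟨E₁, hP⟩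
  have hconj : ∀ g z : G, g * z * g⁻¹ = (g * z * g⁻¹ * z⁻¹) * z := fun g z => by group
  have hMn : M.Normal := by
    refine ⟨fun z hz g => ?_⟩
    have hmap : IsMaxElem ρ (M.map (MulAut.conj g).toMonoidHom) :=
      hM.of_le (hM.1.map _) (le_fixCard_map_conj M g)
    have hsup := (hM.sup_inf hmap (by
      rintro x hx _ ⟨y, hy, rfl⟩
      change x * (g * y * g⁻¹) = g * y * g⁻¹ * x
      rw [hconj g y, ← mul_assoc, ← hMc x hx _ (hcm g y), mul_assoc, hM.1.2 x hx y hy,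
        ← mul_assoc])).1
    have hc : M ⊔ M.map (MulAut.conj g).toMonoidHom ≤ Subgroup.centralizer (commutator G) := by
      refine sup_le (fun x hx => Subgroup.mem_centralizer_iff.2 (hMc x hx)) ?_
      rintro _ ⟨y, hy, rfl⟩
      refine Subgroup.mem_centralizer_iff.2 fun a ha => ?_
      change a * (g * y * g⁻¹) = g * y * g⁻¹ * a
      rw [hconj g y, ← mul_assoc, hmeta a ha _ (hcm g y), mul_assoc, hMc y hy a ha]
      simp only [mul_assoc]
    have hPs : P (M ⊔ M.map (MulAut.conj g).toMonoidHom) :=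
      ⟨hsup, fun h => hM' (le_bot_iff.1 (le_sup_left.trans h.le)),
        fun x hx => Subgroup.mem_centralizer_iff.1 (hc hx)⟩
    exact hmax hPs le_sup_left (le_sup_right (a := M) ⟨z, hz, rfl⟩)
  obtain ⟨B, hBM, hB', -, hBq⟩ := hM.exists_replacement hG hfaithful hM'
  refine hB' (le_bot_iff.1 ?_)
  let Q : Subgroup G :=
    { carrier := {b | b ∈ M ∧ ∀ e ∈ M, ∀ v, ρ b (ρ e v - v) = ρ e v - v}
      mul_mem' := fun {a b} ha hb => ⟨M.mul_mem ha.1 hb.1, fun e he v => by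
        rw [map_mul, Module.End.mul_apply, hb.2 e he, ha.2 e he]⟩
      one_mem' := ⟨M.one_mem, fun e he v => by simp⟩
      inv_mem' := fun {a} ha => ⟨M.inv_mem ha.1, fun e he v => by
        conv_lhs => rw [← ha.2 e he v]
        simp⟩ }
  have hQn : Q.Normal := by
    refine ⟨fun b hb g => ⟨hMn.conj_mem b hb.1 g, fun e he v => ?_⟩⟩
    have h1 : ρ e v - v = ρ g (ρ (g⁻¹ * e * g) (ρ g⁻¹ v) - ρ g⁻¹ v) := by
      simp only [map_sub, ← Module.End.mul_apply, ← map_mul]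
      congr 2
      · group
      · simp
    have h2 : g⁻¹ * e * g ∈ M := by simpa using hMn.conj_mem e he g⁻¹
    rw [map_mul, map_mul, Module.End.mul_apply, Module.End.mul_apply, h1]
    rw [Representation.inv_self_apply, hb.2 _ h2]
  have hQ := eq_bot_of_normal_of_quadratic hG hfaithful hnoquad
    hQn
    fun b hb => hquad b (hb.2 b hb.1)
  rw [← hQ]
  exact fun b hb => ⟨hBM hb, hBq b hb⟩
end

section
/- Let p be an odd prime, G a finite p-group whose p-rank is at most p (every elementary abelian p-subgroup of G has order at most p^p), and V a faithful 𝔽_p G-module such that every non-identity element of Ω₁(Z(G)) acts on V with minimal polynomial X^p − 1. Then V is not an F-module. -/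
open Polynomial

section PGroup

variable {p : ℕ} {G : Type*} [Group G]

/-- A nontrivial normal subgroup of a finite `p`-group contains a central element of order `p`. -/
theorem IsPGroup.exists_mem_center_of_normal [Fact p.Prime] [Finite G] (hG : IsPGroup p G)
    {N : Subgroup G} (hN : N.Normal) (hbot : N ≠ ⊥) : ∃ z ∈ N, z ∈ Subgroup.center G ∧ z ≠ 1 ∧ z ^ p = 1 := by
  have hdvd : p ∣ Nat.card N := by
    have : Nontrivial N := (Subgroup.nontrivial_iff_ne_bot N).mpr hbot
    obtain ⟨n, hn0, hn⟩ := (hG.to_subgroup N).nontrivial_iff_card.mp this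
    exact hn.symm ▸ dvd_pow_self _ hn0.ne'
  obtain ⟨b, hb, hb1⟩ :=
    (hG.of_equiv ConjAct.toConjAct).exists_fixed_point_of_prime_dvd_card_of_fixed_point
      N hdvd (a := 1) (fun g => smul_one g)
  have hbc : (b : G) ∈ Subgroup.center G := by
    rw [Subgroup.mem_center_iff]
    intro g
    have h := congrArg Subtype.val (hb (ConjAct.toConjAct g))
    rw [ConjAct.Subgroup.val_conj_smul, ConjAct.toConjAct_smul] at h
    rw [← mul_inv_eq_iff_eq_mul]
    exact h
  have hb1' : (b : G) ≠ 1 := fun h => hb1 (Subtype.ext h.symm)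
  obtain ⟨k, hk⟩ := IsPGroup.iff_orderOf.mp hG (b : G)
  obtain _ | k := k
  · exact absurd (orderOf_eq_one_iff.mp (by simpa using hk)) hb1'
  · refine ⟨(b : G) ^ p ^ k, N.pow_mem b.2 _, Subgroup.pow_mem _ hbc _, fun h => ?_, ?_⟩
    · have hp : p.Prime := Fact.out
      have := Nat.le_of_dvd (pow_pos hp.pos k) (hk ▸ orderOf_dvd_of_pow_eq_one h)
      exact absurd this (not_le.mpr (Nat.pow_lt_pow_right hp.one_lt k.lt_succ_self))
    · rw [← pow_mul, ← pow_succ, ← hk, pow_orderOf_eq_one]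

/-- Disjoint commuting elementary abelian subgroups generate an elementary abelian subgroup, so the
product of their orders is bounded by any bound on the orders of such subgroups. -/
theorem IsElemAbelian.card_mul_card_le {E F : Subgroup G} (hE : IsElemAbelian p E)
    (hF : IsElemAbelian p F) (hcomm : ∀ x ∈ E, ∀ y ∈ F, x * y = y * x)
    (hdisj : ∀ x ∈ E, x ∈ F → x = 1) {n : ℕ}
    (hrank : ∀ H : Subgroup G, IsElemAbelian p H → Nat.card H ≤ n) :
    Nat.card E * Nat.card F ≤ n := by
  let f : E × F →* G := E.subtype.noncommCoprod F.subtype fun x y => hcomm x x.2 y y.2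
  have hf : ∀ x : E × F, f x = (x.1 : G) * (x.2 : G) := fun x => rfl
  have hinj : Function.Injective f := by
    rw [injective_iff_map_eq_one]
    rintro ⟨⟨x, hx⟩, ⟨y, hy⟩⟩ h
    have h : x * y = 1 := h
    have hxy : x = y⁻¹ := eq_inv_of_mul_eq_one_left h
    have hx1 : x = 1 := hdisj x hx (hxy ▸ F.inv_mem hy)
    subst hx1
    have hy1 : y = 1 := by simpa using h
    subst hy1
    rfl
  rw [← Nat.card_prod, Nat.card_congr (MonoidHom.ofInjective hinj).toEquiv]
  have hab : ∀ a b : E × F, a * b = b * a := fun a b =>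
    Prod.ext (Subtype.ext (hE.2 _ a.1.2 _ b.1.2)) (Subtype.ext (hF.2 _ a.2.2 _ b.2.2))
  refine hrank _ ⟨?_, ?_⟩
  · rintro _ ⟨a, rfl⟩
    rw [← map_pow, ← map_one f]
    exact congrArg f (Prod.ext (Subtype.ext (hE.1 _ a.1.2)) (Subtype.ext (hF.1 _ a.2.2)))
  · rintro _ ⟨a, rfl⟩ _ ⟨b, rfl⟩
    rw [← map_mul, hab, map_mul]

end PGroup

section Nilpotent

variable {K V : Type*} [Field K] [AddCommGroup V] [Module K V] [FiniteDimensional K V]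

/-- A nilpotent endomorphism commuting with one of rank at most `n` has `n`-th power annihilating
the image of the latter. -/
theorem Module.End.pow_mul_eq_zero_of_finrank_range_le {T A : Module.End K V} (hT : IsNilpotent T)
    (hcomm : Commute T A) {n : ℕ} (hn : Module.finrank K (LinearMap.range A) ≤ n) :
    T ^ n * A = 0 := by
  have hmaps : ∀ x ∈ LinearMap.range A, T x ∈ LinearMap.range A := by
    rintro _ ⟨v, rfl⟩
    exact ⟨T v, (LinearMap.congr_fun hcomm.eq v).symm⟩
  set R : Module.End K (LinearMap.range A) := T.restrict hmaps with hR
  have hpow : ∀ k, ∀ x : LinearMap.range A, ((R ^ k) x : V) = (T ^ k) x := by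
    intro k
    induction k with
    | zero => intro x; rfl
    | succ k ih =>
      intro x
      rw [pow_succ', pow_succ', Module.End.mul_apply, Module.End.mul_apply, ← ih]
      rfl
  have hRn : IsNilpotent R := by
    obtain ⟨k, hk⟩ := hT
    exact ⟨k, LinearMap.ext fun x => Subtype.ext (by rw [hpow, hk]; rfl)⟩
  have hR0 : R ^ Module.finrank K (LinearMap.range A) = 0 := by
    have := LinearMap.aeval_self_charpoly R
    rwa [IsNilpotent.charpoly_eq_X_pow_finrank hRn, map_pow, aeval_X] at this
  have hR0 : R ^ n = 0 := pow_eq_zero_of_le hn hR0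
  ext v
  have := congrArg Subtype.val (LinearMap.congr_fun hR0 ⟨A v, v, rfl⟩)
  rw [hpow] at this
  exact this

end Nilpotent

section Unipotent

variable {p : ℕ} [Fact p.Prime] {G V : Type*} [Group G] [AddCommGroup V] [Module (ZMod p) V]
  (ρ : Representation (ZMod p) G V)

theorem Representation.sub_one_pow_eq_zero {g : G} (hg : g ^ p = 1) : (ρ g - 1) ^ p = 0 := by
  have h := congrArg (aeval (ρ g)) (sub_pow_char (R := (ZMod p)[X]) (p := p) X 1)
  rwa [one_pow, map_pow, map_sub, map_sub, map_pow, aeval_X, map_one, ← map_pow, hg, map_one,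
    sub_self] at h

theorem Representation.sub_one_pow_ne_zero {g : G} (hg : minpoly (ZMod p) (ρ g) = X ^ p - 1) {k : ℕ}
    (hk : k < p) : (ρ g - 1) ^ k ≠ 0 := by
  intro h
  have hdvd : minpoly (ZMod p) (ρ g) ∣ (X - C 1) ^ k := minpoly.dvd _ _ (by simpa using h)
  have hle := natDegree_le_of_dvd hdvd (pow_ne_zero _ (X_sub_C_ne_zero 1))
  rw [hg, natDegree_pow, natDegree_X_sub_C, ← C_1, natDegree_X_pow_sub_C] at hle
  omega

/-- If every central element of order `p` has minimal polynomial `X ^ p - 1`, then `ρ x - 1` has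
rank at least `p - 1` for every `x ≠ 1`. -/
theorem Representation.le_finrank_range_sub_one [Finite G] [Finite V] (hp2 : 2 ≤ p)
    (hG : IsPGroup p G)
    (hmin : ∀ g ∈ Subgroup.center G, g ≠ 1 → g ^ p = 1 →
      minpoly (ZMod p) (ρ g) = X ^ p - 1)
    {x : G} (hx : x ≠ 1) : p - 1 ≤ Module.finrank (ZMod p) (LinearMap.range (ρ x - 1)) := by
  by_contra! hlt
  let N : Subgroup G :=
    { carrier := {y | ∀ z ∈ Subgroup.center G, z ^ p = 1 → (ρ z - 1) ^ (p - 2) * (ρ y - 1) = 0}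
      mul_mem' := by
        intro a b ha hb z hz hzp
        have : ρ (a * b) - 1 = (ρ a - 1) * ρ b + (ρ b - 1) := by rw [map_mul]; noncomm_ring
        rw [this, mul_add, ← mul_assoc, ha z hz hzp, hb z hz hzp, zero_mul, add_zero]
      one_mem' := by
        intro z hz hzp
        simp
      inv_mem' := by
        intro a ha z hz hzp
        have h1 : ρ a * ρ a⁻¹ = 1 := by rw [← map_mul, mul_inv_cancel, map_one]
        have : ρ a⁻¹ - 1 = -((ρ a - 1) * ρ a⁻¹) := by rw [sub_mul, h1]; noncomm_ring
        rw [this, mul_neg, ← mul_assoc, ha z hz hzp, zero_mul, neg_zero] }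
  have hcomm : ∀ z ∈ Subgroup.center G, ∀ g : G, Commute (ρ z - 1) (ρ g) := by
    intro z hz g
    have : Commute (ρ z) (ρ g) := by
      rw [Commute, SemiconjBy, ← map_mul, ← map_mul, Subgroup.mem_center_iff.mp hz g]
    exact this.sub_left (Commute.one_left _)
  have hN : N.Normal := ⟨by
    intro y hy g z hz hzp
    have h1 : ρ g * ρ g⁻¹ = 1 := by rw [← map_mul, mul_inv_cancel, map_one]
    have : ρ (g * y * g⁻¹) - 1 = ρ g * (ρ y - 1) * ρ g⁻¹ := by
      rw [mul_sub, sub_mul, mul_one, h1, map_mul, map_mul]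
    rw [this, ← mul_assoc, ← mul_assoc, ((hcomm z hz g).pow_left _).eq, mul_assoc (ρ g),
      hy z hz hzp, mul_zero, zero_mul]⟩
  have hxN : x ∈ N := fun z hz hzp =>
    Module.End.pow_mul_eq_zero_of_finrank_range_le ⟨p, ρ.sub_one_pow_eq_zero hzp⟩
      ((hcomm z hz x).sub_right (Commute.one_right _)) (by omega)
  obtain ⟨z, hzN, hz, hz1, hzp⟩ :=
    hG.exists_mem_center_of_normal hN fun h => hx (by simpa [h] using hxN)
  refine ρ.sub_one_pow_ne_zero (hmin z hz hz1 hzp) (k := p - 2 + 1) (by omega) ?_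
  rw [pow_succ]
  exact hzN z hz hzp

end Unipotent

section Offender

variable {p : ℕ} [Fact p.Prime] {G V : Type*} [Group G] [AddCommGroup V] [Module (ZMod p) V]
  {ρ : Representation (ZMod p) G V}

theorem IsElemAbelian.commute {E : Subgroup G} (hE : IsElemAbelian p E) {e f : G} (he : e ∈ E)
    (hf : f ∈ E) : Commute (ρ e) (ρ f) := by
  rw [Commute, SemiconjBy, ← map_mul, ← map_mul, hE.2 e he f hf]

/-- A vector lying in the sum of its commutators with `E` and the fixed points of `E` is fixed. -/
theorem IsElemAbelian.mem_fixedPts_of_mem_sup {E : Subgroup G} (hE : IsElemAbelian p E) {v : V}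
    (hv : v ∈ fixedPts p ρ E ⊔
      Submodule.span (ZMod p) {w | ∃ e ∈ E, w = (ρ e - 1) v}) :
    v ∈ fixedPts p ρ E := by
  have key : ∀ w ∈ Submodule.span (ZMod p) {w | ∃ e ∈ E, w = (ρ e - 1) v},
      ∃ R : Module.End (ZMod p) V, R v = w ∧ IsNilpotent R ∧ R ∈ Submodule.span (ZMod p)
        {A : Module.End (ZMod p) V | ∃ e ∈ E, A = ρ e - 1} ∧
        ∀ T : Module.End (ZMod p) V, (∀ e ∈ E, Commute T (ρ e)) → Commute T R := by
    intro w hw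
    induction hw using Submodule.span_induction with
    | mem w hw =>
      obtain ⟨e, he, rfl⟩ := hw
      exact ⟨ρ e - 1, rfl, ⟨p, ρ.sub_one_pow_eq_zero (hE.1 e he)⟩,
        Submodule.subset_span ⟨e, he, rfl⟩,
        fun T hT => (hT e he).sub_right (Commute.one_right T)⟩
    | zero => exact ⟨0, rfl, IsNilpotent.zero, zero_mem _, fun T _ => Commute.zero_right T⟩
    | add w₁ w₂ _ _ ih₁ ih₂ =>
      obtain ⟨R₁, h₁, n₁, s₁, c₁⟩ := ih₁
      obtain ⟨R₂, h₂, n₂, s₂, c₂⟩ := ih₂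
      have hc : Commute R₁ R₂ := c₂ R₁ fun e he => (c₁ (ρ e) fun f hf => hE.commute he hf).symm
      exact ⟨R₁ + R₂, by rw [LinearMap.add_apply, h₁, h₂], hc.isNilpotent_add n₁ n₂,
        add_mem s₁ s₂, fun T hT => (c₁ T hT).add_right (c₂ T hT)⟩
    | smul a w _ ih =>
      obtain ⟨R, h, n, s, c⟩ := ih
      exact ⟨a • R, by rw [LinearMap.smul_apply, h], n.smul a, Submodule.smul_mem _ a s,
        fun T hT => (c T hT).smul_right a⟩
  obtain ⟨c, hc, w, hw, hcw⟩ := Submodule.mem_sup.mp hv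
  obtain ⟨R, hRv, ⟨n, hn⟩, hspan, -⟩ := key w hw
  have hRc : R c = 0 := by
    clear hRv hn
    induction hspan using Submodule.span_induction with
    | mem A hA =>
      obtain ⟨e, he, rfl⟩ := hA
      rw [LinearMap.sub_apply, Module.End.one_apply, hc e he, sub_self]
    | zero => rfl
    | add A B _ _ hA hB => rw [LinearMap.add_apply, hA, hB, add_zero]
    | smul a A _ hA => rw [LinearMap.smul_apply, hA, smul_zero]
  have hpow : ∀ k, R v = (R ^ (k + 1)) v := by
    intro k
    induction k with
    | zero => rw [zero_add, pow_one]
    | succ k ih =>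
      have hRR : R v = R (R v) := by
        conv_lhs => rw [← hcw, map_add, hRc, zero_add, ← hRv]
      rw [pow_succ', Module.End.mul_apply, ← ih, ← hRR]
  have hw0 : w = 0 := by
    rw [← hRv, hpow n, pow_succ', hn, mul_zero, LinearMap.zero_apply]
  rwa [← hcw, hw0, add_zero]

/-- A minimal offender is quadratic. -/
theorem IsOffender.isQuadSubgroup_of_minimal [Finite G] [Finite V] {E : Subgroup G}
    (hE : IsOffender p ρ E) (hmin : ∀ F ≤ E, IsOffender p ρ F → F = E) :
    IsQuadSubgroup p ρ E := by
  obtain ⟨hbot, hab, hcard⟩ := hE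
  suffices ∀ v : V, ∀ e ∈ E, (ρ e - 1) v ∈ fixedPts p ρ E by
    intro e he f hf
    ext v
    rw [Module.End.mul_apply, LinearMap.sub_apply, Module.End.one_apply, this v f hf e he, sub_self]
    rfl
  intro v
  set C := fixedPts p ρ E with hC
  set M := Submodule.span (ZMod p) {w | ∃ e ∈ E, w = (ρ e - 1) v} with hM
  have hCstab : ∀ e ∈ E, ∀ c ∈ C, ρ e c ∈ C := fun e he c hc => by rwa [hc e he]
  let F : Subgroup G :=
    { carrier := {x | x ∈ E ∧ (ρ x - 1) v ∈ C}
      mul_mem' := by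
        rintro a b ⟨ha, ha'⟩ ⟨hb, hb'⟩
        refine ⟨mul_mem ha hb, ?_⟩
        have : (ρ (a * b) - 1) v = ρ a ((ρ b - 1) v) + (ρ a - 1) v := by
          simp [map_sub]
        rw [this]
        exact add_mem (hCstab a ha _ hb') ha'
      one_mem' := ⟨one_mem E, by simp⟩
      inv_mem' := by
        rintro a ⟨ha, ha'⟩
        refine ⟨inv_mem ha, ?_⟩
        have : (ρ a⁻¹ - 1) v = -ρ a⁻¹ ((ρ a - 1) v) := by
          simp [map_sub]
        rw [this]
        exact neg_mem (hCstab _ (inv_mem ha) _ ha') }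
  have hFE : F ≤ E := fun x hx => hx.1
  have hMfix : C ⊔ M ≤ fixedPts p ρ F := by
    refine sup_le (fun c hc x hx => hc x hx.1) (Submodule.span_le.mpr ?_)
    rintro _ ⟨e, he, rfl⟩ x ⟨hxE, hx⟩
    have h1 : (ρ e - 1) ((ρ x - 1) v) = 0 := by
      rw [LinearMap.sub_apply, Module.End.one_apply, hx e he, sub_self]
    have h2 : Commute (ρ x - 1) (ρ e - 1) :=
      ((hab.commute hxE he).sub_right (Commute.one_right _)).sub_left (Commute.one_left _)
    rw [← Module.End.mul_apply, ← h2.eq, Module.End.mul_apply, LinearMap.sub_apply,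
      Module.End.one_apply, sub_eq_zero] at h1
    exact h1
  have hindex : Nat.card (E ⧸ F.subgroupOf E) * Nat.card C ≤
      Nat.card (C ⊔ M : Submodule (ZMod p) V) := by
    rw [← Nat.card_prod]
    refine Nat.card_le_card_of_injective
      (fun q : (E ⧸ F.subgroupOf E) × C => (⟨q.2 + (ρ (q.1.out : G) - 1) v,
        Submodule.add_mem_sup q.2.2 (Submodule.subset_span ⟨_, q.1.out.2, rfl⟩)⟩ :
          (C ⊔ M : Submodule (ZMod p) V))) ?_
    rintro ⟨q, c⟩ ⟨q', c'⟩ h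
    have h : (c : V) + (ρ (q.out : G) - 1) v = c' + (ρ (q'.out : G) - 1) v := congrArg Subtype.val h
    have hq : q = q' := by
      rw [← q.out_eq', ← q'.out_eq']
      refine QuotientGroup.eq.mpr ⟨(q.out⁻¹ * q'.out).2, ?_⟩
      have : (ρ ((q.out⁻¹ * q'.out : E) : G) - 1) v =
          ρ ((q.out : G)⁻¹) (((ρ (q'.out : G) - 1) v) - ((ρ (q.out : G) - 1) v)) := by
        simp [map_sub]
      change (ρ ((q.out⁻¹ * q'.out : E) : G) - 1) v ∈ C
      rw [this]
      refine hCstab _ (inv_mem q.out.2) _ ?_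
      have h' : (ρ (q'.out : G) - 1) v - (ρ (q.out : G) - 1) v = c - c' := by
        rw [sub_eq_sub_iff_add_eq_add, h, add_comm]
      rw [h']
      exact sub_mem c.2 c'.2
    subst hq
    exact Prod.ext rfl (Subtype.ext (add_right_cancel h))
  have hEF : Nat.card E = Nat.card (E ⧸ F.subgroupOf E) * Nat.card F := by
    rw [Subgroup.card_eq_card_quotient_mul_card_subgroup (F.subgroupOf E),
      Nat.card_congr (Subgroup.subgroupOfEquivOfLe hFE).toEquiv]
  have hle : Nat.card V ≤ Nat.card F * Nat.card (C ⊔ M : Submodule (ZMod p) V) :=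
    calc Nat.card V ≤ Nat.card E * Nat.card C := hcard
      _ = Nat.card F * (Nat.card (E ⧸ F.subgroupOf E) * Nat.card C) := by rw [hEF]; ring
      _ ≤ _ := Nat.mul_le_mul_left _ hindex
  by_cases hF : F = ⊥
  · have htop : C ⊔ M = ⊤ := by
      rw [hF, Subgroup.card_bot, one_mul] at hle
      have : Function.Surjective ((C ⊔ M).subtype) :=
        ((Nat.bijective_iff_injective_and_card _).mpr ⟨Subtype.val_injective,
          le_antisymm (Nat.card_le_card_of_injective _ Subtype.val_injective) hle⟩).2
      rw [← Submodule.range_subtype (C ⊔ M)]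
      exact LinearMap.range_eq_top.mpr this
    have hvC : v ∈ C := hab.mem_fixedPts_of_mem_sup (by rw [← hC, ← hM, htop]; trivial)
    intro e he
    rw [LinearMap.sub_apply, Module.End.one_apply, hvC e he, sub_self]
    exact zero_mem _
  · have hFoff : IsOffender p ρ F := by
      refine ⟨hF, ⟨fun x hx => hab.1 x hx.1, fun x hx y hy => hab.2 x hx.1 y hy.1⟩, hle.trans ?_⟩
      exact Nat.mul_le_mul_left _
        (Nat.card_le_card_of_injective _ (Submodule.inclusion_injective hMfix))
    intro e he
    rw [← hmin F hFE hFoff] at he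
    exact he.2

end Offender

section Stabilizer

variable {p : ℕ} {G V : Type*} [Group G] [AddCommGroup V] [Module (ZMod p) V]
  (ρ : Representation (ZMod p) G V) (C : Submodule (ZMod p) V)

/-- The setwise stabilizer of a subspace. -/
def subspaceStabilizer : Subgroup G where
  carrier := {g | ∀ v, ρ g v ∈ C ↔ v ∈ C}
  mul_mem' := by
    intro a b ha hb v
    rw [map_mul, Module.End.mul_apply, ha, hb]
  one_mem' := by
    intro v
    rw [map_one, Module.End.one_apply]
  inv_mem' := by
    intro a ha v
    rw [← ha, ← Module.End.mul_apply, ← map_mul, mul_inv_cancel, map_one, Module.End.one_apply]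

/-- The subgroup acting trivially both on a subspace and on the quotient by it. -/
def chainCentralizer : Subgroup G where
  carrier := {g | (∀ v, ρ g v - v ∈ C) ∧ ∀ c ∈ C, ρ g c = c}
  mul_mem' := by
    rintro a b ⟨ha, ha'⟩ ⟨hb, hb'⟩
    refine ⟨fun v => ?_, fun c hc => ?_⟩
    · rw [map_mul, Module.End.mul_apply, ← sub_add_sub_cancel]
      exact add_mem (ha _) (hb v)
    · rw [map_mul, Module.End.mul_apply, hb' c hc, ha' c hc]
  one_mem' := ⟨fun v => by simp, fun c _ => by simp⟩
  inv_mem' := by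
    rintro a ⟨ha, ha'⟩
    refine ⟨fun v => ?_, fun c hc => ?_⟩
    · have h := neg_mem (ha (ρ a⁻¹ v))
      rwa [← Module.End.mul_apply, ← map_mul, mul_inv_cancel, map_one, Module.End.one_apply,
        neg_sub] at h
    · conv_lhs => rw [← ha' c hc]
      rw [← Module.End.mul_apply, ← map_mul, inv_mul_cancel, map_one, Module.End.one_apply]

variable {ρ C}

theorem chainCentralizer_le_subspaceStabilizer :
    chainCentralizer ρ C ≤ subspaceStabilizer ρ C := fun _ hg v =>
  ⟨fun h => by simpa using sub_mem h (hg.1 v), fun h => by simpa using add_mem (hg.1 v) h⟩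

theorem conj_mem_chainCentralizer {g x : G} (hg : g ∈ subspaceStabilizer ρ C)
    (hx : x ∈ chainCentralizer ρ C) : g * x * g⁻¹ ∈ chainCentralizer ρ C := by
  have hinv : ∀ v, ρ g (ρ g⁻¹ v) = v := fun v => by
    rw [← Module.End.mul_apply, ← map_mul, mul_inv_cancel, map_one, Module.End.one_apply]
  refine ⟨fun v => ?_, fun c hc => ?_⟩
  · have h := (hg _).mpr (hx.1 (ρ g⁻¹ v))
    rwa [map_sub, hinv, ← Module.End.mul_apply, ← Module.End.mul_apply, ← map_mul, ← map_mul] at h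
  · rw [map_mul, map_mul, Module.End.mul_apply, Module.End.mul_apply,
      hx.2 _ ((inv_mem hg) c |>.mpr hc), hinv]

/-- If nontrivial elements fixing `C` pointwise have no further fixed points and `g` moves `C`, then
the chain centralizer of `C` meets its conjugate by `g` trivially. -/
theorem eq_one_of_conj_mem_chainCentralizer
    (hfix : ∀ x : G, x ≠ 1 → (∀ c ∈ C, ρ x c = c) → ∀ v, ρ x v = v → v ∈ C) {g : G}
    (hg : g ∉ subspaceStabilizer ρ C) {x : G} (hx : x ∈ chainCentralizer ρ C)
    (hgx : g * x * g⁻¹ ∈ chainCentralizer ρ C) : x = 1 := by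
  by_contra hx1
  refine hg fun v => ?_
  have h1 : ∀ y : G, y ≠ 1 → y ∈ chainCentralizer ρ C → ∀ v, v ∈ C ↔ ρ y v = v :=
    fun y hy1 hy v => ⟨hy.2 v, hfix y hy1 hy.2 v⟩
  rw [h1 x hx1 hx v, h1 _ (fun h => hx1 (conj_eq_one_iff.mp h)) hgx]
  have : ρ (g * x * g⁻¹) (ρ g v) = ρ g (ρ x v) := by
    simp only [← Module.End.mul_apply, ← map_mul, inv_mul_cancel_right]
  rw [this]
  refine ⟨fun h => ?_, fun h => by rw [h]⟩
  have h := congrArg (ρ g⁻¹) h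
  simpa only [← Module.End.mul_apply, ← map_mul, inv_mul_cancel, map_one, one_mul,
    inv_mul_cancel_left, Module.End.one_apply] using h

/-- If moreover `g` normalizes the stabilizer of `C`, then the chain centralizer of `C` commutes with
its conjugate by `g`. -/
theorem commute_conj_of_mem_chainCentralizer
    (hfix : ∀ x : G, x ≠ 1 → (∀ c ∈ C, ρ x c = c) → ∀ v, ρ x v = v → v ∈ C) {g : G}
    (hg : g ∉ subspaceStabilizer ρ C)
    (hgN : g ∈ Subgroup.normalizer (subspaceStabilizer ρ C : Set G))
    {x y : G} (hx : x ∈ chainCentralizer ρ C) (hy : y ∈ chainCentralizer ρ C) :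
    x * (g * y * g⁻¹) = g * y * g⁻¹ * x := by
  have hle : chainCentralizer ρ C ≤ subspaceStabilizer ρ C := chainCentralizer_le_subspaceStabilizer
  have hN := fun h : G => (Subgroup.mem_normalizer_iff.mp hgN h)
  have hy' : g * y * g⁻¹ ∈ subspaceStabilizer ρ C := (hN y).mp (hle hy)
  have hx' : g⁻¹ * x * g ∈ subspaceStabilizer ρ C := by
    rw [hN]
    simpa [mul_assoc] using hle hx
  have h1 : x * (g * y * g⁻¹ * x⁻¹ * (g * y * g⁻¹)⁻¹) ∈ chainCentralizer ρ C :=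
    mul_mem hx (conj_mem_chainCentralizer hy' (inv_mem hx))
  have h2 : g⁻¹ * x * g * y * (g⁻¹ * x * g)⁻¹ * y⁻¹ ∈ chainCentralizer ρ C :=
    mul_mem (conj_mem_chainCentralizer hx' hy) (inv_mem hy)
  have h3 := eq_one_of_conj_mem_chainCentralizer hfix hg h2 (by
    convert h1 using 1
    group)
  have h4 : x * (g * y * g⁻¹) * (g * y * g⁻¹ * x)⁻¹ =
      g * (g⁻¹ * x * g * y * (g⁻¹ * x * g)⁻¹ * y⁻¹) * g⁻¹ := by group
  rw [h3, mul_one, mul_inv_cancel, mul_inv_eq_one] at h4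
  exact h4

end Stabilizer

/-- **Theorem (rank ≤ p case).** Let `p` be an odd prime and `G` a finite `p`-group whose
`p`-rank is at most `p`, i.e. every elementary abelian subgroup of `G` has order at most
`p^p`.  Let `V` be a faithful `𝔽_p G`-module such that every non-identity element of
`Ω₁(Z(G))` acts on `V` with minimal polynomial `X^p - 1`.  Then `V` is not an
`F`-module. -/
theorem stmt4 {p : ℕ} (hp : p.Prime) (hodd : Odd p) {G V : Type*} [Group G] [Finite G]
    [AddCommGroup V] [Module (ZMod p) V] [Finite V]
    (hG : IsPGroup p G)
    (hrank : ∀ E : Subgroup G, IsElemAbelian p E → Nat.card E ≤ p ^ p)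
    (ρ : Representation (ZMod p) G V)
    (hfaithful : Function.Injective ρ)
    (hmin : ∀ g ∈ Subgroup.center G, g ≠ 1 → g ^ p = 1 →
      minpoly (ZMod p) (ρ g) = X ^ p - 1) :
    ¬ ∃ E : Subgroup G, IsOffender p ρ E := by
  rintro ⟨E₀, hE₀⟩
  have : Fact p.Prime := ⟨hp⟩
  have hp3 : 3 ≤ p := by
    obtain ⟨k, rfl⟩ := hodd
    have := hp.two_le
    omega
  obtain ⟨E, hEmin⟩ := (Set.toFinite {E : Subgroup G | IsOffender p ρ E}).exists_minimal ⟨E₀, hE₀⟩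
  have hE : IsOffender p ρ E := hEmin.prop
  have hquad : IsQuadSubgroup p ρ E :=
    hE.isQuadSubgroup_of_minimal fun F hFE hF => le_antisymm hFE (hEmin.le_of_le hF hFE)
  obtain ⟨hbot, hab, hcard⟩ := hE
  set C := fixedPts p ρ E with hC
  have hsq : ∀ z ∈ Subgroup.center G, z ≠ 1 → z ^ p = 1 → (ρ z - 1) * (ρ z - 1) ≠ 0 := by
    intro z hz hz1 hzp
    rw [← sq]
    exact ρ.sub_one_pow_ne_zero (hmin z hz hz1 hzp) (by omega)
  have hker : ∀ x : G, x ≠ 1 → Module.finrank (ZMod p) (LinearMap.ker (ρ x - 1)) + (p - 1) ≤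
      Module.finrank (ZMod p) V := by
    intro x hx
    have h1 := ρ.le_finrank_range_sub_one (by omega) hG hmin hx
    have h2 := (ρ x - 1).finrank_range_add_finrank_ker
    omega
  have hkerC : ∀ x : G, (∀ c ∈ C, ρ x c = c) → C ≤ LinearMap.ker (ρ x - 1) := by
    intro x hx c hc
    rw [LinearMap.mem_ker, LinearMap.sub_apply, hx c hc, Module.End.one_apply, sub_self]
  obtain ⟨e, heE, he1⟩ := E.bot_or_exists_ne_one.resolve_left hbot
  have hEcard : Nat.card E ≤ p ^ (p - 1) := by
    obtain ⟨z, -, hz, hz1, hzp⟩ := hG.exists_mem_center_of_normal (N := ⊤) inferInstance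
      fun h => he1 (Subgroup.mem_bot.mp (h ▸ Subgroup.mem_top e))
    have hle := hab.card_mul_card_le (F := Subgroup.zpowers z)
      ⟨fun x hx => by
          obtain ⟨k, rfl⟩ := hx
          change (z ^ k) ^ p = 1
          rw [← zpow_natCast, zpow_comm, zpow_natCast, hzp, one_zpow],
        fun x hx y hy =>
          (Subgroup.mem_center_iff.mp ((Subgroup.zpowers_le.mpr hz) hx) y).symm⟩
      (fun x _ y hy => Subgroup.mem_center_iff.mp ((Subgroup.zpowers_le.mpr hz) hy) x)
      (fun x hxE hxz => by
        by_contra hx1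
        exact hsq x ((Subgroup.zpowers_le.mpr hz) hxz) hx1 (hab.1 x hxE) (hquad x hxE x hxE))
      hrank
    rw [Nat.card_zpowers, orderOf_eq_prime hzp hz1] at hle
    refine Nat.le_of_mul_le_mul_right (hle.trans_eq ?_) hp.pos
    rw [← pow_succ, Nat.sub_add_cancel hp.one_le]
  have hcodim : Module.finrank (ZMod p) V = Module.finrank (ZMod p) C + (p - 1) := by
    refine le_antisymm ?_ ?_
    · have h := hcard.trans (Nat.mul_le_mul_right _ hEcard)
      rw [Module.natCard_eq_pow_finrank (K := ZMod p) (V := V),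
        Module.natCard_eq_pow_finrank (K := ZMod p) (V := C), Nat.card_zmod, ← pow_add,
        Nat.pow_le_pow_iff_right hp.one_lt] at h
      omega
    · exact (Nat.add_le_add_right (Submodule.finrank_mono (hkerC e fun c hc => hc e heE)) _).trans
        (hker e he1)
  have hEcard' : p ^ (p - 1) ≤ Nat.card E := by
    rw [Module.natCard_eq_pow_finrank (K := ZMod p) (V := V),
      Module.natCard_eq_pow_finrank (K := ZMod p) (V := C), Nat.card_zmod, hcodim, pow_add,
      mul_comm] at hcard
    exact Nat.le_of_mul_le_mul_right hcard (pow_pos hp.pos _)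
  have hfix : ∀ x : G, x ≠ 1 → (∀ c ∈ C, ρ x c = c) → ∀ v, ρ x v = v → v ∈ C := by
    intro x hx1 hx v hv
    have hk := hker x hx1
    rw [Submodule.eq_of_le_of_finrank_le (hkerC x hx) (by omega), LinearMap.mem_ker,
      LinearMap.sub_apply, Module.End.one_apply, hv, sub_self]
  have hED : E ≤ chainCentralizer ρ C := by
    refine fun x hx => ⟨fun v f hf => ?_, fun c hc => hc x hx⟩
    have h := LinearMap.congr_fun (hquad f hf x hx) v
    exact sub_eq_zero.mp h
  by_cases htop : subspaceStabilizer ρ C = ⊤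
  · obtain ⟨z, hzD, hz, hz1, hzp⟩ := hG.exists_mem_center_of_normal (N := chainCentralizer ρ C)
      ⟨fun x hx g => conj_mem_chainCentralizer (htop ▸ Subgroup.mem_top g) hx⟩
      (ne_bot_of_le_ne_bot hbot hED)
    refine hsq z hz hz1 hzp (LinearMap.ext fun v => ?_)
    exact sub_eq_zero.mpr (hzD.2 _ (hzD.1 v))
  · have := hG.isNilpotent
    obtain ⟨g, hgN, hg⟩ := SetLike.exists_of_lt
      (Group.normalizerCondition_of_isNilpotent (G := G) _ (lt_top_iff_ne_top.mpr htop))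
    have hle := hab.card_mul_card_le (F := E.map (MulAut.conj g).toMonoidHom)
      ⟨by
          rintro _ ⟨y, hy, rfl⟩
          rw [← map_pow, hab.1 y hy, map_one],
        by
          rintro _ ⟨x, hx, rfl⟩ _ ⟨y, hy, rfl⟩
          rw [← map_mul, hab.2 x hx y hy, map_mul]⟩
      (by
        rintro x hx _ ⟨y, hy, rfl⟩
        exact commute_conj_of_mem_chainCentralizer hfix hg hgN (hED hx) (hED hy))
      (by
        rintro _ hx ⟨y, hy, rfl⟩
        rw [eq_one_of_conj_mem_chainCentralizer hfix hg (hED hy) (hED hx), map_one])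
      hrank
    rw [Subgroup.card_map_of_injective (MulAut.conj g).injective] at hle
    have h := (Nat.mul_le_mul hEcard' hEcard').trans hle
    rw [← pow_add, Nat.pow_le_pow_iff_right hp.one_lt] at h
    omega
end

section
/- Let p be a prime, G a finite p-group, and V a faithful 𝔽_p G-module such that no non-identity element of Ω₁(Z(G)) is quadratic on V. Then a quadratic offender E ≤ G contains no nontrivial normal subgroup of G: if N ⊴ G and N ≤ E, then N = 1. -/
open Polynomial

/-- A nontrivial normal subgroup of a finite `p`-group contains a nontrivial central element. -/
theorem IsPGroup.exists_mem_center_of_normal_ne_bot {p : ℕ} [Fact p.Prime] {G : Type*} [Group G]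
    [Finite G] (hG : IsPGroup p G) (N : Subgroup G) [N.Normal] (hN : N ≠ ⊥) :
    ∃ z ∈ N, z ∈ Subgroup.center G ∧ z ≠ 1 := by
  have : Nontrivial N := (Subgroup.nontrivial_iff_ne_bot N).mpr hN
  have hdvd : p ∣ Nat.card N := by
    obtain ⟨n, hn0, hn⟩ := (hG.to_subgroup N).nontrivial_iff_card.mp inferInstance
    exact hn.symm ▸ dvd_pow_self _ hn0.ne'
  obtain ⟨z, hz, hz1⟩ :=
    (hG.of_equiv ConjAct.toConjAct).exists_fixed_point_of_prime_dvd_card_of_fixed_point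
      N hdvd (a := 1) fun g => smul_one g
  refine ⟨z, z.2, Subgroup.mem_center_iff.mpr fun g => ?_, fun h => hz1 (Subtype.ext h.symm)⟩
  have h := congrArg Subtype.val (hz (ConjAct.toConjAct g))
  rw [ConjAct.Subgroup.val_conj_smul, ConjAct.toConjAct_smul] at h
  exact mul_inv_eq_iff_eq_mul.mp h

/-- **Lemma.** Let `p` be a prime, `G` a finite `p`-group and `V` a faithful `𝔽_p G`-module
such that no non-identity element of `Ω₁(Z(G))` is quadratic on `V`.  Then a quadratic
offender `E ≤ G` contains no nontrivial normal subgroup of `G`. -/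
theorem stmt10 {p : ℕ} (hp : p.Prime) {G V : Type*} [Group G] [Finite G]
    [AddCommGroup V] [Module (ZMod p) V] [Finite V]
    (hG : IsPGroup p G) (ρ : Representation (ZMod p) G V)
    (hfaithful : Function.Injective ρ)
    (hnoquad : ∀ g ∈ Subgroup.center G, g ^ p = 1 → ¬ IsQuadElt p ρ g)
    (E : Subgroup G) (hE : IsOffender p ρ E) (hEquad : IsQuadSubgroup p ρ E)
    (N : Subgroup G) (hN : N.Normal) (hNE : N ≤ E) :
    N = ⊥ := by
  have : Fact p.Prime := ⟨hp⟩
  by_contra hbot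
  obtain ⟨z, hzN, hzc, hz1⟩ := hG.exists_mem_center_of_normal_ne_bot N hbot
  have hzE := hNE hzN
  refine hnoquad z hzc (hE.2.1.1 z hzE) ⟨hz1, ?_⟩
  rw [sq]
  exact hEquad z hzE z hzE
end

section
/- Let G be a finite p-group, A an abelian subgroup of G such that [A,B] = 1 for every G-conjugate B of A, and V an 𝔽_p G-module such that [V,A,A] = 0 and V = C_V(A) + C_V(B) for every G-conjugate B ≠ A of A. Then [V,A] ⊆ C_V(H), where H is the normal closure of A in G. -/
open Polynomial

/-- **Lemma.** Let `G` be a finite `p`-group, `A` an abelian subgroup of `G` such that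
`[A,B] = 1` for every `G`-conjugate `B = A^g` of `A`, and `V` an `𝔽_p G`-module with
`[V,A,A] = 0` and `V = C_V(A) + C_V(B)` for every `G`-conjugate `B ≠ A` of `A`.  Then
`[V,A] ⊆ C_V(H)`, where `H` is the normal closure of `A` in `G`: every element
`v·(a-1)` (`v ∈ V`, `a ∈ A`) is fixed by the normal closure of `A`. -/
theorem stmt11 {p : ℕ} (hp : p.Prime) {G V : Type*} [Group G] [Finite G]
    [AddCommGroup V] [Module (ZMod p) V] [Finite V]
    (hG : IsPGroup p G) (ρ : Representation (ZMod p) G V)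
    (A : Subgroup G)
    (hcomm : ∀ g : G, ∀ a ∈ A, ∀ b ∈ A.map (MulAut.conj g).toMonoidHom,
      a * b = b * a)
    (hquad : IsQuadSubgroup p ρ A)
    (hdecomp : ∀ g : G, A.map (MulAut.conj g).toMonoidHom ≠ A →
      fixedPts p ρ A ⊔ fixedPts p ρ (A.map (MulAut.conj g).toMonoidHom) = ⊤) :
    ∀ v : V, ∀ a ∈ A,
      ρ a v - v ∈ fixedPts p ρ (Subgroup.normalClosure (A : Set G)) := by
  intro v a ha
  have hconj : ∀ g : G, ∀ b ∈ A.map (MulAut.conj g).toMonoidHom,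
      ρ b (ρ a v - v) = ρ a v - v := by
    intro g b hb
    by_cases hA : A.map (MulAut.conj g).toMonoidHom = A
    · rw [hA] at hb
      have h := LinearMap.congr_fun (hquad b hb a ha) v
      simpa [sub_eq_zero] using h
    · have hv : v ∈ fixedPts p ρ A ⊔ fixedPts p ρ (A.map (MulAut.conj g).toMonoidHom) := by
        rw [hdecomp g hA]
        exact Submodule.mem_top
      obtain ⟨x, hx, y, hy, rfl⟩ := Submodule.mem_sup.mp hv
      have hba : ρ b (ρ a y) = ρ a y := by
        rw [← Module.End.mul_apply, ← map_mul, ← hcomm g a ha b hb, map_mul,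
          Module.End.mul_apply, hy b hb]
      have hxy : ρ a (x + y) - (x + y) = ρ a y - y := by
        rw [map_add, hx a ha]
        abel
      rw [hxy, map_sub, hba, hy b hb]
  intro h hh
  induction hh using Subgroup.closure_induction with
  | mem b hb =>
    obtain ⟨c, hc, hcb⟩ := Group.mem_conjugatesOfSet_iff.mp hb
    obtain ⟨g, rfl⟩ := isConj_iff.mp hcb
    exact hconj g _ ⟨c, hc, rfl⟩
  | one => simp
  | mul x y _ _ hx hy => rw [map_mul, Module.End.mul_apply, hy, hx]
  | inv x _ hx =>
    conv_lhs => rw [← hx]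
    rw [← Module.End.mul_apply, ← map_mul, inv_mul_cancel, map_one, Module.End.one_apply]
end

section
/- Let p be an odd prime, G a finite p-group, and V a faithful 𝔽_p G-module such that every non-identity element of Ω₁(Z(G)) acts on V with minimal polynomial X^p − 1. If E ≤ G is an offender on V, then the rank of E is at least p−1, i.e. |E| ≥ p^{p−1}. -/
open Polynomial

/-- A nontrivial normal subgroup of a finite `p`-group contains a central element of order `p`. -/
theorem IsPGroup.exists_mem_center_orderOf_eq {p : ℕ} [Fact p.Prime] {G : Type*} [Group G]
    [Finite G] (hG : IsPGroup p G) {N : Subgroup G} [N.Normal] (hN : N ≠ ⊥) :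
    ∃ z ∈ N, z ∈ Subgroup.center G ∧ orderOf z = p := by
  have hdvd : p ∣ Nat.card N :=
    (hG.to_subgroup N).card_eq_or_dvd.resolve_left fun h => hN (Subgroup.card_eq_one.mp h)
  have hC : IsPGroup p (ConjAct G) := hG.of_equiv ConjAct.toConjAct
  obtain ⟨z, hz, hne⟩ := hC.exists_fixed_point_of_prime_dvd_card_of_fixed_point N hdvd
    (a := 1) (fun g => smul_one g)
  have hzc : (z : G) ∈ Subgroup.center G := by
    rw [← SetLike.mem_coe, ← ConjAct.fixedPoints_eq_center]
    exact fun g => congrArg Subtype.val (hz g)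
  have hz1 : (z : G) ≠ 1 := fun h => hne (Subtype.ext h.symm)
  obtain ⟨k, hk⟩ := IsPGroup.iff_orderOf.mp hG (z : G)
  have hpz : p ∣ orderOf (z : G) := hG.dvd_orderOf hz1
  refine ⟨(z : G) ^ (orderOf (z : G) / p), pow_mem z.2 _, pow_mem hzc _, ?_⟩
  exact orderOf_pow_orderOf_div (orderOf_pos _).ne' hpz

/-- A nilpotent endomorphism stabilising a subspace `W` maps everything into `W` once its exponent
reaches the codimension of `W`. -/
theorem IsNilpotent.pow_apply_mem_of_finrank_quotient_le {K V : Type*} [Field K] [AddCommGroup V]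
    [Module K V] [FiniteDimensional K V] {f : Module.End K V} (hf : IsNilpotent f)
    {W : Submodule K V} (hW : W ≤ W.comap f) {n : ℕ} (hn : Module.finrank K (V ⧸ W) ≤ n) (v : V) :
    (f ^ n) v ∈ W := by
  obtain ⟨m, hm⟩ := hf
  have hker := Module.End.ker_pow_le_ker_pow_finrank (W.mapQ W f hW) m
  have hv : (W.mapQ W f hW ^ m) (W.mkQ v) = 0 := by
    rw [← W.mapQ_pow hW]
    simp [hm]
  have h := Module.End.pow_map_zero_of_le hn
    (LinearMap.mem_ker.mp (hker (LinearMap.mem_ker.mpr hv)))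
  rw [← W.mapQ_pow hW] at h
  simpa using h

section Offender

variable {p : ℕ} {G V : Type*} [Group G] [AddCommGroup V] [Module (ZMod p) V]

theorem IsOffender.finrank_quotient_lt [Fact p.Prime] [Finite V]
    {ρ : Representation (ZMod p) G V} {E : Subgroup G} (hE : IsOffender p ρ E) {n : ℕ}
    (hn : Nat.card E < p ^ n) : Module.finrank (ZMod p) (V ⧸ fixedPts p ρ E) < n := by
  have hV := hE.2.2
  rw [(fixedPts p ρ E).card_eq_card_quotient_mul_card, mul_comm] at hV
  have hle := (Nat.le_of_mul_le_mul_right hV Nat.card_pos).trans_lt hn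
  rw [Module.natCard_eq_pow_finrank (K := ZMod p), Nat.card_zmod] at hle
  exact (Nat.pow_lt_pow_iff_right (Fact.out : p.Prime).one_lt).mp hle

/-- If an endomorphism `f` commutes with `G` and maps into the fixed points of `E`, it maps into
the fixed points of the normal closure of `E`. -/
theorem apply_mem_fixedPts_normalClosure {ρ : Representation (ZMod p) G V} {E : Subgroup G}
    {f : Module.End (ZMod p) V} (hf : ∀ g, Commute f (ρ g))
    (h : ∀ v, f v ∈ fixedPts p ρ E) (v : V) :
    f v ∈ fixedPts p ρ (Subgroup.normalClosure (E : Set G)) := by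
  intro g hg
  induction hg using Subgroup.closure_induction generalizing v with
  | mem x hx =>
    obtain ⟨e, he, hconj⟩ := Group.mem_conjugatesOfSet_iff.mp hx
    obtain ⟨c, rfl⟩ := isConj_iff.mp hconj
    have hc (g : G) (w : V) : ρ g (f w) = f (ρ g w) := (LinearMap.congr_fun (hf g).eq w).symm
    rw [map_mul, map_mul, Module.End.mul_apply, Module.End.mul_apply, hc c⁻¹, h _ e he, ← hc c⁻¹,
      Representation.self_inv_apply]
  | one => simp
  | mul x y _ _ hx hy => rw [map_mul, Module.End.mul_apply, hy, hx]
  | inv x _ hx =>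
    conv_lhs => rw [← hx v]
    exact ρ.inv_self_apply x _

end Offender

/-- **Lemma.** Let `p` be an odd prime, `G` a finite `p`-group and `V` a faithful
`𝔽_p G`-module such that every non-identity element of `Ω₁(Z(G))` acts on `V` with
minimal polynomial `X^p - 1`.  If `E ≤ G` is an offender on `V`, then the rank of `E` is
at least `p - 1`, i.e. `|E| ≥ p^{p-1}`. -/
theorem stmt16 {p : ℕ} (hp : p.Prime) (hodd : Odd p) {G V : Type*} [Group G] [Finite G]
    [AddCommGroup V] [Module (ZMod p) V] [Finite V]
    (hG : IsPGroup p G) (ρ : Representation (ZMod p) G V)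
    (hfaithful : Function.Injective ρ)
    (hmin : ∀ g ∈ Subgroup.center G, g ≠ 1 → g ^ p = 1 →
      minpoly (ZMod p) (ρ g) = X ^ p - 1)
    (E : Subgroup G) (hE : IsOffender p ρ E) :
    p ^ (p - 1) ≤ Nat.card E := by
  have : Fact p.Prime := ⟨hp⟩
  by_contra! hlt
  have hcodim := hE.finrank_quotient_lt hlt
  have hN : Subgroup.normalClosure (E : Set G) ≠ ⊥ := fun h =>
    hE.1 (le_bot_iff.mp (Subgroup.le_normalClosure.trans h.le))
  obtain ⟨z, hzN, hzc, hzp⟩ := hG.exists_mem_center_orderOf_eq hN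
  have hz1 : z ≠ 1 := by
    rintro rfl
    exact hp.one_lt.ne (by simpa using hzp)
  have hzpow : z ^ p = 1 := hzp ▸ pow_orderOf_eq_one z
  have hcomm (g : G) : Commute (ρ z) (ρ g) := by
    rw [commute_iff_eq, ← map_mul, ← map_mul, Subgroup.mem_center_iff.mp hzc g]
  have hf (n : ℕ) (g : G) : Commute ((ρ z - 1) ^ n) (ρ g) :=
    ((hcomm g).sub_left (Commute.one_left _)).pow_left n
  have hstab : fixedPts p ρ E ≤ (fixedPts p ρ E).comap (ρ z - 1) := by
    intro v hv e he
    have hc : Commute (ρ z - 1) (ρ e) := by simpa using hf 1 e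
    rw [← Module.End.mul_apply, ← hc.eq, Module.End.mul_apply, hv e he]
  have hXp : (X - 1 : (ZMod p)[X]) ^ p = X ^ p - 1 := by
    rw [sub_pow_char, one_pow]
  have hnil : IsNilpotent (ρ z - 1) := by
    refine ⟨p, ?_⟩
    have h := minpoly.aeval (ZMod p) (ρ z)
    rw [hmin z hzc hz1 hzpow, ← hXp] at h
    simpa using h
  have hfix := apply_mem_fixedPts_normalClosure (hf (p - 2)) fun v =>
    hnil.pow_apply_mem_of_finrank_quotient_le hstab (n := p - 2) (by omega) v
  have hzero : (ρ z - 1) ^ (p - 1) = 0 := by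
    rw [show p - 1 = p - 2 + 1 by have := hp.two_le; omega, pow_succ']
    ext v
    have := hfix v z hzN
    rw [Module.End.mul_apply, LinearMap.sub_apply, this]
    simp
  have hdvd : minpoly (ZMod p) (ρ z) ∣ (X - C 1) ^ (p - 1) :=
    minpoly.dvd _ _ (by simpa using hzero)
  have hdeg := natDegree_le_of_dvd hdvd (pow_ne_zero _ (X_sub_C_ne_zero 1))
  rw [hmin z hzc hz1 hzpow, natDegree_pow, natDegree_X_sub_C, ← C_1, natDegree_X_pow_sub_C] at hdeg
  have := hp.two_le
  omega
end
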